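/- Let d ∈ ℕ, θ, η ∈ (0, ∞] and r > (1/η − 1/θ)_+. Then σ_m(S^r_θ A)_{A_η} ≍ m^{1/η − 1/θ − r} · (log* m)^{(d−1)r}. -/

import Mathlib

open MeasureTheory Real ENNReal

noncomputable section

namespace Paper

/-- The fundamental domain `[0,1)^d` of the `d`-dimensional torus `𝕋^d`. -/
def cube (d : ℕ) : Set (Fin d → ℝ) := Set.univ.pi fun _ => Set.Ico (0:ℝ) 1

/-- The trigonometric character `x ↦ e^{2π i k·x}`. -/
def expk (d : ℕ) (k : Fin d → ℤ) (x : Fin d → ℝ) : ℂ :=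
  Complex.exp (((2 * Real.pi * ∑ i, (k i : ℝ) * x i : ℝ) : ℂ) * Complex.I)

/-- Fourier coefficient `f̂(k) = ∫_{[0,1)^d} f(x) e^{-2π i k·x} dx`. -/
def fCoeff (d : ℕ) (f : (Fin d → ℝ) → ℂ) (k : Fin d → ℤ) : ℂ :=
  ∫ x in cube d, f x * expk d (-k) x

/-- The `L_q` (quasi-)norm on the torus, `q ∈ (0,∞]`, valued in `ℝ≥0∞`
(for `q = ∞` this is the essential supremum). -/
def LqNorm (d : ℕ) (q : ℝ≥0∞) (f : (Fin d → ℝ) → ℂ) : ℝ≥0∞ :=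
  eLpNorm f q (volume.restrict (cube d))

/-- The weight `∏_{i=1}^d (1+|k_i|)`. -/
def wt (d : ℕ) (k : Fin d → ℤ) : ℝ := ∏ i, (1 + |(k i : ℝ)|)

/-- The weighted Wiener (quasi-)norm `‖f‖_{S^r_θ A}`
(with the sup modification for `θ = ∞`); `A_θ` corresponds to `r = 0`,
the Wiener algebra `A` to `r = 0`, `θ = 1`. -/
def wienerNorm (d : ℕ) (r : ℝ) (θ : ℝ≥0∞) (f : (Fin d → ℝ) → ℂ) : ℝ≥0∞ :=
  if θ = ∞ then ⨆ k : Fin d → ℤ, ENNReal.ofReal (wt d k ^ r) * (‖fCoeff d f k‖₊ : ℝ≥0∞)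
  else (∑' k : Fin d → ℤ,
      (ENNReal.ofReal (wt d k ^ r) * (‖fCoeff d f k‖₊ : ℝ≥0∞)) ^ θ.toReal) ^ (1 / θ.toReal)

/-- Trigonometric polynomials with at most `m` terms. -/
def trigPoly (d m : ℕ) : Set ((Fin d → ℝ) → ℂ) :=
  {s | ∃ (Λ : Finset (Fin d → ℤ)) (a : (Fin d → ℤ) → ℂ),
    Λ.card ≤ m ∧ s = fun x => ∑ k ∈ Λ, a k * expk d k x}

/-- Best `m`-term trigonometric approximation error of `f`, error measured by `X`. -/
def sigmaF (d m : ℕ) (X : ((Fin d → ℝ) → ℂ) → ℝ≥0∞) (f : (Fin d → ℝ) → ℂ) : ℝ≥0∞ :=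
  ⨅ s ∈ trigPoly d m, X (f - s)

/-- The unit ball of the space (inside `L₁(𝕋^d)`) with (quasi-)norm `N`. -/
def unitBall (d : ℕ) (N : ((Fin d → ℝ) → ℂ) → ℝ≥0∞) : Set ((Fin d → ℝ) → ℂ) :=
  {f | IntegrableOn f (cube d) ∧ N f ≤ 1}

/-- Best `m`-term trigonometric width of the unit ball of `N`, error measured by `X`. -/
def sigmaClass (d m : ℕ) (N X : ((Fin d → ℝ) → ℂ) → ℝ≥0∞) : ℝ≥0∞ :=
  ⨆ f ∈ unitBall d N, sigmaF d m X f

/-- `log*(m) = max (log₂ m) 1`. -/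
def logStar (m : ℕ) : ℝ := max (Real.logb 2 m) 1

/-- Two-sided asymptotic equivalence `a_m ≍ b_m`. -/
def IsAsympEquiv (a : ℕ → ℝ≥0∞) (b : ℕ → ℝ) : Prop :=
  ∃ c C : ℝ, 0 < c ∧ 0 < C ∧ ∃ m₀ : ℕ, ∀ m : ℕ, m₀ ≤ m →
    ENNReal.ofReal (c * b m) ≤ a m ∧ a m ≤ ENNReal.ofReal (C * b m)

/-- One-sided asymptotic bound `a_m ≲ b_m`. -/
def IsAsympLe (a : ℕ → ℝ≥0∞) (b : ℕ → ℝ) : Prop :=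
  ∃ C : ℝ, 0 < C ∧ ∃ m₀ : ℕ, ∀ m : ℕ, m₀ ≤ m → a m ≤ ENNReal.ofReal (C * b m)

/-- Dyadic block `I_0 = {0}`, `I_n = {k : 2^{n-1} ≤ |k| < 2^n}` for `n ≥ 1`. -/
def blockF (n : ℕ) : Finset ℤ :=
  (Finset.Icc (-(2^n : ℤ)) (2^n)).filter fun k =>
    (n = 0 ∧ k = 0) ∨ (n ≠ 0 ∧ 2^(n-1) ≤ |k| ∧ |k| < 2^n)

/-- The dyadic block projection `∑_{k ∈ I_j} f̂(k) e^{2π i k·x}`. -/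
def blockProj (d : ℕ) (f : (Fin d → ℝ) → ℂ) (j : Fin d → ℕ) : (Fin d → ℝ) → ℂ :=
  fun x => ∑ k ∈ Fintype.piFinset (fun i => blockF (j i)), fCoeff d f k * expk d k x

/-- The mixed-smoothness Besov (quasi-)norm `‖f‖_{S^s_{p,θ}B}`
(with the sup modification for `θ = ∞`). -/
def besovNorm (d : ℕ) (s : ℝ) (p θ : ℝ≥0∞) (f : (Fin d → ℝ) → ℂ) : ℝ≥0∞ :=
  if θ = ∞ then
    ⨆ j : Fin d → ℕ,
      ENNReal.ofReal ((2:ℝ) ^ (((∑ i, j i : ℕ) : ℝ) * s)) * LqNorm d p (blockProj d f j)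
  else
    (∑' j : Fin d → ℕ,
      (ENNReal.ofReal ((2:ℝ) ^ (((∑ i, j i : ℕ) : ℝ) * s)) * LqNorm d p (blockProj d f j))
        ^ θ.toReal) ^ (1 / θ.toReal)

/-- The mixed-smoothness Sobolev norm `‖f‖_{S^s_p W}` (Littlewood–Paley form),
with `S^0_p W := L_p`. -/
def sobolevNorm (d : ℕ) (s : ℝ) (p : ℝ≥0∞) (f : (Fin d → ℝ) → ℂ) : ℝ≥0∞ :=
  if s = 0 then LqNorm d p f
  else
    (∫⁻ x in cube d,
      ((∑' j : Fin d → ℕ,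
        (ENNReal.ofReal ((2:ℝ) ^ (((∑ i, j i : ℕ) : ℝ) * s)) *
          (‖blockProj d f j x‖₊ : ℝ≥0∞)) ^ (2:ℕ)) ^ ((1:ℝ)/2)) ^ p.toReal) ^ (1 / p.toReal)

/-- Trigonometric polynomials with frequencies in `[-M,M]^d`. -/
def boxPoly (d M : ℕ) : Set ((Fin d → ℝ) → ℂ) :=
  {s | ∃ (Λ : Finset (Fin d → ℤ)) (a : (Fin d → ℤ) → ℂ),
    (∀ k ∈ Λ, ∀ i, |k i| ≤ (M : ℤ)) ∧ s = fun x => ∑ k ∈ Λ, a k * expk d k x}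

/-- Error of best approximation by trigonometric polynomials with
frequencies in `[-M,M]^d`, measured in `L_∞`. -/
def EBox (d M : ℕ) (f : (Fin d → ℝ) → ℂ) : ℝ≥0∞ :=
  ⨅ g ∈ boxPoly d M, LqNorm d ∞ (f - g)

/-- The `m`-th (non-linear) sampling width of the class of continuous functions
in the unit ball of `N`, error measured in `L_q`. -/
def samplingWidth (d m : ℕ) (N : ((Fin d → ℝ) → ℂ) → ℝ≥0∞) (q : ℝ≥0∞) : ℝ≥0∞ :=
  ⨅ (t : Fin m → (Fin d → ℝ)) (_ : ∀ i, t i ∈ cube d)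
    (R : (Fin m → ℂ) → ((Fin d → ℝ) → ℂ)),
    ⨆ f ∈ {f : (Fin d → ℝ) → ℂ | Continuous f ∧ N f ≤ 1},
      LqNorm d q (f - R fun i => f (t i))



lemma one_le_wt (d : ℕ) (k : Fin d → ℤ) : 1 ≤ wt d k :=
  Finset.one_le_prod fun i _ => by
    have := abs_nonneg (k i : ℝ)
    simp only [ge_iff_le]
    linarith

lemma wt_pos (d : ℕ) (k : Fin d → ℤ) : 0 < wt d k :=
  zero_lt_one.trans_le (one_le_wt d k)

lemma wt_succ (n : ℕ) (k : Fin (n + 1) → ℤ) :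
    wt (n + 1) k = (1 + |(k 0 : ℝ)|) * wt n (Fin.tail k) :=
  Fin.prod_univ_succ _

lemma one_add_abs_le_wt (d : ℕ) (k : Fin d → ℤ) (i : Fin d) : 1 + |(k i : ℝ)| ≤ wt d k := by
  rw [wt, ← Finset.mul_prod_erase _ _ (Finset.mem_univ i)]
  refine le_mul_of_one_le_right (by positivity) (Finset.one_le_prod fun j _ => ?_)
  have := abs_nonneg (k j : ℝ)
  simp only [ge_iff_le]
  linarith

/-- The hyperbolic cross `{k : ∏ (1 + |k_i|) ≤ M}`, cut off to the cube `(-N, N)^d`. -/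
def hyperbolicCross (d N : ℕ) (M : ℝ) : Finset (Fin d → ℤ) :=
  (Fintype.piFinset fun _ => Finset.Ioo (-(N : ℤ)) N).filter fun k => wt d k ≤ M

lemma mem_hyperbolicCross {d N : ℕ} {M : ℝ} (hM : M ≤ N) (k : Fin d → ℤ) :
    k ∈ hyperbolicCross d N M ↔ wt d k ≤ M := by
  simp only [hyperbolicCross, Finset.mem_filter, Fintype.mem_piFinset, Finset.mem_Ioo,
    and_iff_right_iff_imp]
  intro h i
  have h1 := (one_add_abs_le_wt d k i).trans (h.trans hM)
  rw [← abs_lt]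
  have : ((|k i| : ℤ) : ℝ) < N := by push_cast; linarith
  exact_mod_cast this

lemma sum_Ioo_inv_le (N : ℕ) :
    ∑ k ∈ Finset.Ioo (-(N : ℤ)) N, (1 + |(k : ℝ)|)⁻¹ ≤ 2 * (1 + Real.log N) := by
  have hmaps : ∀ k ∈ Finset.Ioo (-(N : ℤ)) N, k.natAbs ∈ Finset.range N := by
    intro k hk
    rw [Finset.mem_Ioo] at hk
    rw [Finset.mem_range]
    omega
  rw [← Finset.sum_fiberwise_of_maps_to hmaps]
  have key : ∀ j ∈ Finset.range N,
      ∑ k ∈ Finset.Ioo (-(N : ℤ)) N with k.natAbs = j, (1 + |(k : ℝ)|)⁻¹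
        ≤ 2 * ((j : ℝ) + 1)⁻¹ := by
    intro j _
    have hsub : (Finset.Ioo (-(N : ℤ)) N).filter (fun k => k.natAbs = j) ⊆ {(j : ℤ), -(j : ℤ)} := by
      intro k hk
      simp only [Finset.mem_filter, Finset.mem_insert, Finset.mem_singleton] at hk ⊢
      omega
    have hcard := (Finset.card_le_card hsub).trans Finset.card_le_two
    have hval : ∀ k ∈ (Finset.Ioo (-(N : ℤ)) N).filter (fun k => k.natAbs = j),
        (1 + |(k : ℝ)|)⁻¹ ≤ ((j : ℝ) + 1)⁻¹ := by
      intro k hk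
      have hk := (Finset.mem_filter.1 hk).2
      rw [← hk, Nat.cast_natAbs, Int.cast_abs, add_comm]
    refine (Finset.sum_le_card_nsmul _ _ _ hval).trans ?_
    rw [nsmul_eq_mul]
    gcongr
    exact_mod_cast hcard
  refine (Finset.sum_le_sum key).trans ?_
  rw [← Finset.mul_sum]
  have h := harmonic_le_one_add_log N
  simp only [harmonic, Rat.cast_sum, Rat.cast_inv, Rat.cast_natCast] at h
  push_cast at h
  linarith

lemma card_hyperbolicCross_le (n N : ℕ) {M : ℝ} (hM : 0 ≤ M) :
    ((hyperbolicCross (n + 1) N M).card : ℝ) ≤ 2 * M * (2 * (1 + Real.log N)) ^ n := by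
  classical
  set B : Finset (Fin n → ℤ) := Fintype.piFinset fun _ => Finset.Ioo (-(N : ℤ)) N
  have hmaps : ∀ k ∈ hyperbolicCross (n + 1) N M, Fin.tail k ∈ B := by
    intro k hk
    simp only [hyperbolicCross, Finset.mem_filter, Fintype.mem_piFinset] at hk
    exact Fintype.mem_piFinset.2 fun i => hk.1 i.succ
  have hfib : ∀ b ∈ B, (((hyperbolicCross (n + 1) N M).filter fun k => Fin.tail k = b).card : ℝ)
      ≤ 2 * M * ∏ i, (1 + |(b i : ℝ)|)⁻¹ := by
    intro b _
    set y : ℝ := M / wt n b with hy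
    have hW := wt_pos n b
    have hy0 : 0 ≤ y := by positivity
    have hcard : ((hyperbolicCross (n + 1) N M).filter fun k => Fin.tail k = b).card
        ≤ (Finset.Ioo (-(⌊y⌋₊ : ℤ)) ⌊y⌋₊).card := by
      refine Finset.card_le_card_of_injOn (fun k => k 0) ?_ ?_
      · intro k hk
        simp only [hyperbolicCross, Finset.coe_filter, Finset.mem_filter, Set.mem_ofPred_eq] at hk
        obtain ⟨⟨-, hk⟩, rfl⟩ := hk
        rw [wt_succ, ← le_div_iff₀ hW, ← hy] at hk
        have h1 : ((k 0).natAbs + 1 : ℕ) ≤ ⌊y⌋₊ := by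
          apply Nat.le_floor
          push_cast
          rw [Nat.cast_natAbs, Int.cast_abs]
          linarith
        simp only [Finset.coe_Ioo, Set.mem_Ioo]
        omega
      · intro k hk l hl h
        simp only [Finset.coe_filter, Set.mem_ofPred_eq] at hk hl
        rw [← Fin.cons_self_tail k, ← Fin.cons_self_tail l, hk.2, hl.2]
        simp only at h
        rw [h]
    rw [Int.card_Ioo] at hcard
    have h2 : ((hyperbolicCross (n + 1) N M).filter fun k => Fin.tail k = b).card
        ≤ 2 * ⌊y⌋₊ := by omega
    calc _ ≤ ((2 * ⌊y⌋₊ : ℕ) : ℝ) := by exact_mod_cast h2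
      _ ≤ 2 * y := by push_cast; linarith [Nat.floor_le hy0]
      _ = _ := by rw [hy, wt, Finset.prod_inv_distrib]; ring
  rw [Finset.card_eq_sum_card_fiberwise hmaps]
  push_cast
  refine (Finset.sum_le_sum hfib).trans ?_
  rw [← Finset.mul_sum, Finset.sum_prod_piFinset (Finset.Ioo (-(N : ℤ)) N) (fun _ k => (1 + |(k : ℝ)|)⁻¹),
    Finset.prod_const, Finset.card_univ, Fintype.card_fin]
  gcongr
  exact sum_Ioo_inv_le N

/-- A box-shaped piece of the hyperbolic cross has large cardinality. -/
lemma exists_finset_wt_le (n Q : ℕ) {M : ℝ} (hQ : (Q : ℝ) ^ n ≤ M) :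
    ∃ Λ : Finset (Fin (n + 1) → ℤ), (∀ k ∈ Λ, wt (n + 1) k ≤ M) ∧
      M / 2 * Real.log (Q + 1) ^ n ≤ Λ.card := by
  classical
  have hM : 0 ≤ M := le_trans (by positivity) hQ
  set B : Finset (Fin n → ℕ) := Fintype.piFinset fun _ => Finset.range Q with hB
  set W : (Fin n → ℕ) → ℝ := fun b => ∏ i, ((b i : ℝ) + 1) with hW
  have hWpos : ∀ b, 0 < W b := fun b => Finset.prod_pos fun i _ => by positivity
  set S : Finset (Σ _ : Fin n → ℕ, ℕ) := B.sigma fun b => Finset.range ⌊M / W b⌋₊ with hS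
  set g : (Σ _ : Fin n → ℕ, ℕ) → (Fin (n + 1) → ℤ) :=
    fun p => Fin.cons (p.2 : ℤ) (fun i => (p.1 i : ℤ)) with hg
  have hginj : Function.Injective g := by
    rintro ⟨b, z⟩ ⟨b', z'⟩ h
    obtain ⟨h1, h2⟩ := Fin.cons_inj.1 h
    have h3 : b = b' := funext fun i => by exact_mod_cast congrFun h2 i
    have h4 : z = z' := by exact_mod_cast h1
    rw [h3, h4]
  refine ⟨S.image g, ?_, ?_⟩
  · intro k hk
    obtain ⟨⟨b, z⟩, hp, rfl⟩ := Finset.mem_image.1 hk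
    simp only [hS, Finset.mem_sigma, Finset.mem_range] at hp
    have hz : ((z + 1 : ℕ) : ℝ) ≤ M / W b :=
      (Nat.le_floor_iff (by have := hWpos b; positivity)).1 hp.2
    rw [le_div_iff₀ (hWpos b)] at hz
    rw [wt_succ]
    refine le_trans (le_of_eq ?_) hz
    simp only [hg, hW, wt, Fin.cons_zero, Fin.tail_cons]
    push_cast
    simp only [Nat.abs_cast, add_comm]
  · rw [Finset.card_image_of_injective _ hginj, hS, Finset.card_sigma]
    push_cast
    simp only [Finset.card_range]
    have hlow : ∀ b ∈ B, M / 2 * ∏ i, ((b i : ℝ) + 1)⁻¹ ≤ (⌊M / W b⌋₊ : ℝ) := by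
      intro b hb
      have hWM : W b ≤ M := by
        refine le_trans ?_ hQ
        calc W b ≤ ∏ _i : Fin n, (Q : ℝ) := by
              refine Finset.prod_le_prod (fun i _ => by positivity) fun i _ => ?_
              have := Finset.mem_range.1 (Fintype.mem_piFinset.1 hb i)
              exact_mod_cast this
          _ = _ := by simp
      have h1 : 1 ≤ M / W b := (one_le_div (hWpos b)).2 hWM
      have h2 : (1 : ℝ) ≤ ⌊M / W b⌋₊ := by
        exact_mod_cast Nat.le_floor (by simpa using h1)
      have h3 := Nat.lt_floor_add_one (M / W b)
      have h4 : M / 2 * ∏ i, ((b i : ℝ) + 1)⁻¹ = M / W b / 2 := by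
        rw [Finset.prod_inv_distrib]
        simp only [hW]
        ring
      rw [h4]
      linarith
    refine le_trans ?_ (Finset.sum_le_sum hlow)
    rw [← Finset.mul_sum, Finset.sum_prod_piFinset (Finset.range Q) (fun _ k => ((k : ℝ) + 1)⁻¹),
      Finset.prod_const, Finset.card_univ, Fintype.card_fin]
    have h := log_add_one_le_harmonic Q
    simp only [harmonic, Rat.cast_sum, Rat.cast_inv, Rat.cast_natCast] at h
    push_cast at h
    have hlog : 0 ≤ Real.log ((Q : ℝ) + 1) := Real.log_nonneg (by linarith [Q.cast_nonneg (α := ℝ)])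
    gcongr

lemma continuous_expk (d : ℕ) (k : Fin d → ℤ) : Continuous (expk d k) := by
  unfold expk
  fun_prop

lemma norm_expk (d : ℕ) (k : Fin d → ℤ) (x : Fin d → ℝ) : ‖expk d k x‖ = 1 :=
  Complex.norm_exp_ofReal_mul_I _

lemma expk_mul_neg (d : ℕ) (l k : Fin d → ℤ) (x : Fin d → ℝ) :
    expk d l x * expk d (-k) x = ∏ i, Complex.exp ((2 * π * (l i - k i : ℤ) * Complex.I) * x i) := by
  rw [expk, expk, ← Complex.exp_add, ← Complex.exp_sum]
  congr 1
  simp only [Pi.neg_apply, Int.cast_neg]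
  push_cast
  simp only [Finset.mul_sum, Finset.sum_mul, ← Finset.sum_add_distrib]
  exact Finset.sum_congr rfl fun i _ => by ring

lemma integral_Ico_exp (n : ℤ) :
    ∫ x in Set.Ico (0 : ℝ) 1, Complex.exp ((2 * π * n * Complex.I) * x) = if n = 0 then 1 else 0 := by
  rw [integral_Ico_eq_integral_Ioc, ← intervalIntegral.integral_of_le zero_le_one]
  split_ifs with h
  · simp [h]
  · have hc : (2 * π * n * Complex.I : ℂ) ≠ 0 := by
      simp [h, Real.pi_ne_zero, Complex.I_ne_zero]
    rw [integral_exp_mul_complex hc]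
    have : Complex.exp (2 * π * n * Complex.I) = 1 :=
      Complex.exp_eq_one_iff.2 ⟨n, by ring⟩
    simp [this]

lemma fCoeff_expk (d : ℕ) (l k : Fin d → ℤ) :
    fCoeff d (expk d l) k = if k = l then 1 else 0 := by
  unfold fCoeff cube
  simp only [expk_mul_neg]
  rw [volume_pi, Measure.restrict_pi_pi,
    integral_fintype_prod_eq_prod (μ := fun _ : Fin d => volume.restrict (Set.Ico (0 : ℝ) 1))
      (fun i (x : ℝ) => Complex.exp ((2 * π * (l i - k i : ℤ) * Complex.I) * x))]
  simp only [integral_Ico_exp, sub_eq_zero]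
  rw [Finset.prod_ite_zero]
  simp [funext_iff, eq_comm]

lemma integrableOn_expk (d : ℕ) (k : Fin d → ℤ) : IntegrableOn (expk d k) (cube d) := by
  have hfin : volume (cube d) < ∞ := by
    rw [cube, Real.volume_pi_Ico]
    simp
  have : IsFiniteMeasure (volume.restrict (cube d)) := ⟨by simpa using hfin⟩
  exact Integrable.of_bound (continuous_expk d k).aestronglyMeasurable 1
    (ae_of_all _ fun x => (norm_expk d k x).le)

lemma integrable_mul_expk {d : ℕ} {f : (Fin d → ℝ) → ℂ} (hf : IntegrableOn f (cube d))
    (k : Fin d → ℤ) : Integrable (fun x => f x * expk d k x) (volume.restrict (cube d)) :=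
  hf.mul_bdd (c := 1) (continuous_expk d k).aestronglyMeasurable
    (ae_of_all _ fun x => (norm_expk d k x).le)

lemma integrableOn_trigPoly (d : ℕ) (Λ : Finset (Fin d → ℤ)) (a : (Fin d → ℤ) → ℂ) :
    IntegrableOn (fun x => ∑ k ∈ Λ, a k * expk d k x) (cube d) :=
  integrable_finsetSum _ fun k _ => (integrableOn_expk d k).const_mul (a k)

lemma fCoeff_trigPoly (d : ℕ) (Λ : Finset (Fin d → ℤ)) (a : (Fin d → ℤ) → ℂ) (k : Fin d → ℤ) :
    fCoeff d (fun x => ∑ l ∈ Λ, a l * expk d l x) k = if k ∈ Λ then a k else 0 := by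
  have h : ∀ l, ∫ x in cube d, a l * expk d l x * expk d (-k) x
      = if k = l then a l else 0 := by
    intro l
    simp only [mul_assoc]
    rw [integral_const_mul]
    have := fCoeff_expk d l k
    rw [fCoeff] at this
    rw [this]
    simp
  unfold fCoeff
  simp only [Finset.sum_mul]
  rw [integral_finsetSum _ fun l _ => integrable_mul_expk ((integrableOn_expk d l).const_mul (a l)) _]
  simp only [h, Finset.sum_ite_eq]

lemma fCoeff_sub_trigPoly {d : ℕ} {f : (Fin d → ℝ) → ℂ} (hf : IntegrableOn f (cube d))
    (Λ : Finset (Fin d → ℤ)) (a : (Fin d → ℤ) → ℂ) (k : Fin d → ℤ) :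
    fCoeff d (f - fun x => ∑ l ∈ Λ, a l * expk d l x) k
      = fCoeff d f k - if k ∈ Λ then a k else 0 := by
  rw [← fCoeff_trigPoly d Λ a k]
  unfold fCoeff
  simp only [Pi.sub_apply, sub_mul]
  exact integral_sub (integrable_mul_expk hf _) (integrable_mul_expk (integrableOn_trigPoly d Λ a) _)

lemma wienerNorm_top (d : ℕ) (r : ℝ) (f : (Fin d → ℝ) → ℂ) :
    wienerNorm d r ∞ f = ⨆ k, ENNReal.ofReal (wt d k ^ r * ‖fCoeff d f k‖) := by
  rw [wienerNorm, if_pos rfl]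
  refine iSup_congr fun k => ?_
  rw [ENNReal.ofReal_mul (Real.rpow_nonneg (wt_pos d k).le _), ofReal_norm, enorm_eq_nnnorm]

lemma wienerNorm_of_ne_top (d : ℕ) (r : ℝ) {θ : ℝ≥0∞} (hθ : θ ≠ ∞) (f : (Fin d → ℝ) → ℂ) :
    wienerNorm d r θ f = (∑' k, ENNReal.ofReal ((wt d k ^ r * ‖fCoeff d f k‖) ^ θ.toReal))
      ^ (1 / θ.toReal) := by
  rw [wienerNorm, if_neg hθ]
  congr 1
  refine tsum_congr fun k => ?_
  have h := Real.rpow_nonneg (wt_pos d k).le r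
  rw [← ENNReal.ofReal_rpow_of_nonneg (by positivity) ENNReal.toReal_nonneg,
    ENNReal.ofReal_mul h, ofReal_norm, enorm_eq_nnnorm]

/-- A Chebyshev-type bound: few weighted Fourier coefficients are large. -/
lemma exists_finset_wt_mul_fCoeff_le {d : ℕ} {r : ℝ} {θ : ℝ≥0∞} (hθ : 0 < θ)
    {f : (Fin d → ℝ) → ℂ} (hf : wienerNorm d r θ f ≤ 1) {y : ℝ} (hy : 0 < y) :
    ∃ A : Finset (Fin d → ℤ), (A.card : ℝ) ≤ y ∧
      ∀ k ∉ A, wt d k ^ r * ‖fCoeff d f k‖ ≤ y⁻¹ ^ (1 / θ.toReal) := by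
  by_cases hθt : θ = ∞
  · subst hθt
    refine ⟨∅, by simpa using hy.le, fun k _ => ?_⟩
    rw [wienerNorm_top] at hf
    have := (le_iSup _ k).trans hf
    simpa using this
  · have hp : 0 < θ.toReal := ENNReal.toReal_pos hθ.ne' hθt
    rw [wienerNorm_of_ne_top d r hθt, one_div, ENNReal.rpow_inv_le_iff hp, ENNReal.one_rpow] at hf
    obtain ⟨hfin, hcard⟩ := ENNReal.finset_card_const_le_le_of_tsum_le ENNReal.one_ne_top hf
      (ε := ENNReal.ofReal y⁻¹) (by simpa using hy)
    refine ⟨hfin.toFinset, ?_, fun k hk => ?_⟩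
    · have hinv : 1 / ENNReal.ofReal y⁻¹ = ENNReal.ofReal y := by
        rw [ENNReal.ofReal_inv_of_pos hy, one_div, inv_inv]
      replace hcard := hcard.trans_eq hinv
      rw [← ENNReal.ofReal_natCast] at hcard
      exact (ENNReal.ofReal_le_ofReal_iff hy.le).1 hcard
    · simp only [Set.Finite.mem_toFinset, Set.mem_ofPred_eq, not_le] at hk
      have h := Real.rpow_nonneg (wt_pos d k).le r
      have hk := ((ENNReal.ofReal_lt_ofReal_iff (by positivity)).1 hk).le
      rw [one_div]
      exact (Real.le_rpow_inv_iff_of_pos (by positivity) (by positivity) hp).2 hk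

/-- Decay of the rearranged Fourier coefficients in the unit ball of `S^r_θ A`. -/
lemma exists_finset_fCoeff_le (n : ℕ) {r : ℝ} (hr : 0 < r) {θ : ℝ≥0∞} (hθ : 0 < θ)
    {f : (Fin (n + 1) → ℝ) → ℂ} (hf : wienerNorm (n + 1) r θ f ≤ 1) {N : ℕ} (hN : 1 ≤ N) :
    ∃ A : Finset (Fin (n + 1) → ℤ), A.card ≤ N ∧ ∀ k ∉ A, ‖fCoeff (n + 1) f k‖ ≤
      2 ^ (1 / θ.toReal) * (4 * 2 ^ n) ^ r *
        ((N : ℝ) ^ (-(1 / θ.toReal + r)) * (1 + Real.log N) ^ (n * r)) := by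
  classical
  have hN1 : (1 : ℝ) ≤ N := by exact_mod_cast hN
  have hN0 : (0 : ℝ) < N := by linarith
  have hlog := Real.log_nonneg hN1
  set L := 1 + Real.log N with hL
  have hL1 : 1 ≤ L := by linarith
  have hL0 : 0 < L := by linarith
  set M : ℝ := N / (4 * (2 * L) ^ n) with hM
  have hM0 : 0 < M := by positivity
  have hMN : M ≤ N := by
    refine div_le_self hN0.le ?_
    have : (1 : ℝ) ≤ (2 * L) ^ n := one_le_pow₀ (by linarith)
    linarith
  obtain ⟨A, hA, hAk⟩ := exists_finset_wt_mul_fCoeff_le hθ hf (half_pos hN0)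
  refine ⟨A ∪ hyperbolicCross (n + 1) N M, ?_, fun k hk => ?_⟩
  · have h1 := card_hyperbolicCross_le n N hM0.le
    rw [← hL] at h1
    have h2 : 2 * M * (2 * L) ^ n = N / 2 := by
      rw [hM]
      field_simp
      norm_num
    have h3 : ((A ∪ hyperbolicCross (n + 1) N M).card : ℝ)
        ≤ A.card + (hyperbolicCross (n + 1) N M).card := by
      exact_mod_cast Finset.card_union_le _ _
    have : ((A ∪ hyperbolicCross (n + 1) N M).card : ℝ) ≤ N := by linarith
    exact_mod_cast this
  · rw [Finset.mem_union, not_or, mem_hyperbolicCross hMN, not_le] at hk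
    have h1 := hAk k hk.1
    have h2 : M ^ r ≤ wt (n + 1) k ^ r := Real.rpow_le_rpow hM0.le hk.2.le hr.le
    have h3 : M ^ r * ‖fCoeff (n + 1) f k‖ ≤ ((N : ℝ) / 2)⁻¹ ^ (1 / θ.toReal) :=
      (mul_le_mul_of_nonneg_right h2 (norm_nonneg _)).trans h1
    rw [mul_comm, ← le_div_iff₀ (by positivity)] at h3
    refine h3.trans (le_of_eq ?_)
    rw [hM, mul_pow, ← mul_assoc, Real.div_rpow hN0.le (by positivity),
      Real.mul_rpow (by positivity) (by positivity), ← Real.rpow_natCast L n,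
      ← Real.rpow_mul hL0.le, inv_div, Real.div_rpow (by norm_num) hN0.le, neg_add,
      Real.rpow_add hN0, Real.rpow_neg hN0.le, Real.rpow_neg hN0.le]
    field_simp

lemma tsum_ite_le_tsum_mul {ι : Type*} [DecidableEq ι] (a : ι → ℝ≥0∞) (A : ℕ → Finset ι)
    (c t : ℕ → ℝ≥0∞) (hcard : ∀ j, ((A (j + 1)).card : ℝ≥0∞) ≤ c j) (hc : ∀ j, 1 ≤ c j)
    (hA : ∀ j, ∀ k ∉ A j, a k ≤ t j) :
    ∑' k, (if k ∈ A 0 then 0 else a k) ≤ ∑' j, c j * t j := by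
  by_cases htop : ∑' j, c j * t j = ∞
  · rw [htop]
    exact le_top
  have hterm : ∀ k, (if k ∈ A 0 then 0 else a k) ≤ ∑' j, if k ∈ A (j + 1) then t j else 0 := by
    intro k
    split_ifs with h0
    · exact zero_le
    by_cases hex : ∃ j, k ∈ A j
    · obtain ⟨i, hi⟩ : ∃ i, Nat.find hex = i + 1 :=
        Nat.exists_eq_succ_of_ne_zero fun h => h0 (h ▸ Nat.find_spec hex)
      have h1 : k ∈ A (i + 1) := hi ▸ Nat.find_spec hex
      have h2 : k ∉ A i := Nat.find_min hex (by omega)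
      refine (hA i k h2).trans ?_
      refine le_trans (le_of_eq ?_) (ENNReal.le_tsum i)
      rw [if_pos h1]
    · push Not at hex
      have hle : ∀ j, a k ≤ c j * t j := fun j =>
        (hA j k (hex j)).trans (le_mul_of_one_le_left zero_le (hc j))
      exact (ge_of_tendsto' (ENNReal.tendsto_atTop_zero_of_tsum_ne_top htop) hle).trans zero_le
  refine (ENNReal.tsum_le_tsum hterm).trans ?_
  rw [ENNReal.tsum_comm]
  refine ENNReal.tsum_le_tsum fun j => ?_
  rw [tsum_eq_sum (s := A (j + 1)) (fun k hk => if_neg hk),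
    Finset.sum_congr rfl (fun k hk => if_pos hk), Finset.sum_const, nsmul_eq_mul]
  exact mul_le_mul_left (hcard j) _

lemma summable_two_pow_mul_rpow {α β p : ℝ} (h : 1 < α * p) :
    Summable fun j : ℕ => (2 : ℝ) ^ (j + 1) * (((2 : ℝ) ^ j) ^ (-α) * (1 + (j : ℝ)) ^ β) ^ p := by
  set q : ℝ := (2 : ℝ) ^ (1 - α * p) with hq
  have hq0 : 0 < q := by positivity
  have hq1 : q < 1 := Real.rpow_lt_one_of_one_lt_of_neg (by norm_num) (by linarith)
  set K := ⌈β * p⌉₊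
  have hs : Summable fun j : ℕ => ((j : ℝ) ^ K * q ^ j) :=
    summable_pow_mul_geometric_of_norm_lt_one K (by rwa [Real.norm_of_nonneg hq0.le])
  have hs' := ((summable_nat_add_iff 1).2 hs).mul_left (2 * q⁻¹)
  refine Summable.of_nonneg_of_le (fun j => by positivity) (fun j => ?_) hs'
  have h1 : (1 + (j : ℝ)) ^ (β * p) ≤ (1 + (j : ℝ)) ^ K := by
    rw [← Real.rpow_natCast]
    exact Real.rpow_le_rpow_of_exponent_le (by linarith [j.cast_nonneg (α := ℝ)]) (Nat.le_ceil _)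
  have h2 : (2 : ℝ) ^ j * (((2 : ℝ) ^ j) ^ (-α)) ^ p = q ^ j := by
    rw [hq, ← Real.rpow_natCast, ← Real.rpow_natCast, ← Real.rpow_mul (by norm_num),
      ← Real.rpow_mul (by norm_num), ← Real.rpow_mul (by norm_num), ← Real.rpow_add (by norm_num)]
    congr 1
    ring
  rw [Real.mul_rpow (by positivity) (by positivity), ← Real.rpow_mul (by positivity) β p]
  calc (2 : ℝ) ^ (j + 1) * ((((2 : ℝ) ^ j) ^ (-α)) ^ p * (1 + (j : ℝ)) ^ (β * p))
      = 2 * ((2 : ℝ) ^ j * (((2 : ℝ) ^ j) ^ (-α)) ^ p) * (1 + (j : ℝ)) ^ (β * p) := by ring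
    _ = 2 * q ^ j * (1 + (j : ℝ)) ^ (β * p) := by rw [h2]
    _ ≤ 2 * q ^ j * (1 + (j : ℝ)) ^ K := by gcongr
    _ = _ := by
      push_cast
      field_simp
      ring

lemma rpow_mul_one_add_log_le {α β : ℝ} (hβ : 0 ≤ β) {m : ℕ} (hm : 1 ≤ m) (j : ℕ) :
    ((2 ^ j * m : ℕ) : ℝ) ^ (-α) * (1 + Real.log (2 ^ j * m : ℕ)) ^ β ≤
      (m : ℝ) ^ (-α) * (1 + Real.log m) ^ β * (((2 : ℝ) ^ j) ^ (-α) * (1 + (j : ℝ)) ^ β) := by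
  have hm1 : (1 : ℝ) ≤ m := by exact_mod_cast hm
  have hlog := Real.log_nonneg hm1
  have hlog2 := Real.log_two_lt_d9
  push_cast
  rw [Real.log_mul (by positivity) (by positivity), Real.log_pow,
    Real.mul_rpow (by positivity) (by positivity)]
  have h : 1 + (j * Real.log 2 + Real.log m) ≤ (1 + Real.log m) * (1 + j) := by
    have h1 : (j : ℝ) * Real.log 2 ≤ j * 1 := by gcongr; linarith
    have h2 : 0 ≤ Real.log m * j := by positivity
    linarith
  calc _ ≤ ((2 : ℝ) ^ j) ^ (-α) * (m : ℝ) ^ (-α) * ((1 + Real.log m) * (1 + j)) ^ β := by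
        gcongr
    _ = _ := by
        rw [Real.mul_rpow (by positivity) (by positivity)]
        ring

lemma sigmaF_le_wienerNorm_ite {d m : ℕ} {η : ℝ≥0∞} {f : (Fin d → ℝ) → ℂ}
    (hf : IntegrableOn f (cube d)) (A : Finset (Fin d → ℤ)) (hA : A.card ≤ m) :
    ∃ g, sigmaF d m (wienerNorm d 0 η) f ≤ wienerNorm d 0 η g ∧
      ∀ k, fCoeff d g k = if k ∈ A then 0 else fCoeff d f k := by
  refine ⟨f - fun x => ∑ k ∈ A, fCoeff d f k * expk d k x, iInf₂_le _ ⟨A, _, hA, rfl⟩, fun k => ?_⟩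
  rw [fCoeff_sub_trigPoly hf]
  split_ifs <;> simp

lemma exists_sigmaClass_le (n : ℕ) {r : ℝ} (hr : 0 < r) {θ η : ℝ≥0∞} (hθ : 0 < θ) (hη : 0 < η)
    (hrη : 1 / η.toReal - 1 / θ.toReal < r) :
    ∃ C : ℝ, 0 < C ∧ ∀ m : ℕ, 1 ≤ m →
      sigmaClass (n + 1) m (wienerNorm (n + 1) r θ) (wienerNorm (n + 1) 0 η) ≤
        ENNReal.ofReal (C * ((m : ℝ) ^ (1 / η.toReal - 1 / θ.toReal - r) *
          (1 + Real.log m) ^ (n * r))) := by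
  classical
  set α := 1 / θ.toReal + r with hα
  set β := (n : ℝ) * r with hβ
  set K : ℝ := 2 ^ (1 / θ.toReal) * (4 * 2 ^ n) ^ r with hK
  have hK0 : 0 < K := by positivity
  have hβ0 : 0 ≤ β := by positivity
  by_cases hηt : η = ∞
  · subst hηt
    refine ⟨K, hK0, fun m hm => iSup₂_le fun f hf => ?_⟩
    obtain ⟨A, hA, hAk⟩ := exists_finset_fCoeff_le n hr hθ hf.2 hm
    obtain ⟨g, hg, hgk⟩ := sigmaF_le_wienerNorm_ite (η := ∞) hf.1 A hA
    refine hg.trans ?_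
    rw [wienerNorm_top]
    refine iSup_le fun k => ENNReal.ofReal_le_ofReal ?_
    have hlog := Real.log_natCast_nonneg m
    rw [hgk, Real.rpow_zero, one_mul, ENNReal.toReal_top, _root_.div_zero,
      show (0 : ℝ) - 1 / θ.toReal - r = -α by rw [hα]; ring]
    split_ifs with hk
    · rw [norm_zero]
      positivity
    · exact hAk k hk
  · set p := η.toReal with hp
    have hp0 : 0 < p := ENNReal.toReal_pos hη.ne' hηt
    have hαp : 1 < α * p := by
      rw [← div_lt_iff₀ hp0]
      linarith
    set u : ℕ → ℝ := fun j => ((2 : ℝ) ^ j) ^ (-α) * (1 + (j : ℝ)) ^ β with hu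
    have hu0 : ∀ j, 0 ≤ u j := fun j => by positivity
    have hsum : Summable fun j : ℕ => (2 : ℝ) ^ (j + 1) * u j ^ p :=
      summable_two_pow_mul_rpow hαp
    set S := ∑' j : ℕ, (2 : ℝ) ^ (j + 1) * u j ^ p with hS
    have hS0 : 0 < S := hsum.tsum_pos (fun j => by have := hu0 j; positivity) 0 (by simp [hu])
    refine ⟨K * S ^ (1 / p), by positivity, fun m hm => iSup₂_le fun f hf => ?_⟩
    have hm0 : (0 : ℝ) < m := by exact_mod_cast hm
    have hlog := Real.log_natCast_nonneg m
    set T : ℝ := (m : ℝ) ^ (-α) * (1 + Real.log m) ^ β with hT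
    have hT0 : 0 < T := by positivity
    have hex : ∀ j : ℕ, ∃ A : Finset (Fin (n + 1) → ℤ), A.card ≤ 2 ^ j * m ∧
        ∀ k ∉ A, ‖fCoeff (n + 1) f k‖ ≤ K * T * u j := by
      intro j
      have hN : 1 ≤ 2 ^ j * m := Nat.mul_pos (by positivity) hm
      obtain ⟨A, hA, hAk⟩ := exists_finset_fCoeff_le n hr hθ hf.2 hN
      refine ⟨A, hA, fun k hk => (hAk k hk).trans ?_⟩
      rw [mul_assoc K T]
      exact mul_le_mul_of_nonneg_left (rpow_mul_one_add_log_le hβ0 hm j) hK0.le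
    choose A hA hAk using hex
    obtain ⟨g, hg, hgk⟩ := sigmaF_le_wienerNorm_ite (m := m) (η := η) hf.1 (A 0) (by simpa using hA 0)
    refine hg.trans ?_
    rw [wienerNorm_of_ne_top _ _ hηt, ← hp]
    have hbound := tsum_ite_le_tsum_mul (fun k => ENNReal.ofReal (‖fCoeff (n + 1) f k‖ ^ p)) A
      (fun j => ENNReal.ofReal (2 ^ (j + 1) * m)) (fun j => ENNReal.ofReal ((K * T * u j) ^ p))
      (fun j => by
        rw [← ENNReal.ofReal_natCast]
        exact ENNReal.ofReal_le_ofReal (by exact_mod_cast hA (j + 1)))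
      (fun j => by
        rw [ENNReal.one_le_ofReal]
        exact_mod_cast Nat.mul_pos (by positivity) hm)
      (fun j k hk => ENNReal.ofReal_le_ofReal
        (Real.rpow_le_rpow (norm_nonneg _) (hAk j k hk) hp0.le))
    have hlhs : ∑' k, ENNReal.ofReal ((wt (n + 1) k ^ (0 : ℝ) * ‖fCoeff (n + 1) g k‖) ^ p)
        = ∑' k, if k ∈ A 0 then 0 else ENNReal.ofReal (‖fCoeff (n + 1) f k‖ ^ p) := by
      refine tsum_congr fun k => ?_
      rw [hgk, Real.rpow_zero, one_mul]
      split_ifs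
      · rw [norm_zero, Real.zero_rpow hp0.ne', ENNReal.ofReal_zero]
      · rfl
    have hrhs : ∑' j, ENNReal.ofReal (2 ^ (j + 1) * m) * ENNReal.ofReal ((K * T * u j) ^ p)
        = ENNReal.ofReal (m * (K * T) ^ p * S) := by
      rw [hS, ← tsum_mul_left, ENNReal.ofReal_tsum_of_nonneg
        (fun j => by have := hu0 j; positivity) (hsum.mul_left _)]
      refine tsum_congr fun j => ?_
      rw [← ENNReal.ofReal_mul (by positivity), Real.mul_rpow (by positivity) (hu0 j)]
      congr 1
      ring
    rw [hlhs]
    refine (ENNReal.rpow_le_rpow (hbound.trans_eq hrhs) (by positivity)).trans (le_of_eq ?_)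
    rw [ENNReal.ofReal_rpow_of_nonneg (by positivity) (by positivity)]
    congr 1
    rw [Real.mul_rpow (by positivity) hS0.le, Real.mul_rpow hm0.le (by positivity),
      ← Real.rpow_mul (by positivity), mul_one_div_cancel hp0.ne', Real.rpow_one,
      show 1 / p - 1 / θ.toReal - r = 1 / p + -α by rw [hα]; ring, Real.rpow_add hm0]
    ring

/-- The flat trigonometric polynomial on `2m` frequencies of small weight is hard to approximate. -/
lemma ofReal_le_sigmaClass {d m : ℕ} (hm : 1 ≤ m) {r : ℝ} (hr : 0 < r) {θ η : ℝ≥0∞} (hθ : 0 < θ)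
    (hη : 0 < η) {M : ℝ} (hM : 0 < M) {Λ : Finset (Fin d → ℤ)} (hcard : Λ.card = 2 * m)
    (hΛ : ∀ k ∈ Λ, wt d k ≤ M) :
    ENNReal.ofReal (M ^ (-r) * (2 * m : ℝ) ^ (-(1 / θ.toReal)) * (m : ℝ) ^ (1 / η.toReal)) ≤
      sigmaClass d m (wienerNorm d r θ) (wienerNorm d 0 η) := by
  classical
  have hm0 : (0 : ℝ) < m := by exact_mod_cast hm
  set c : ℝ := M ^ (-r) * (2 * m : ℝ) ^ (-(1 / θ.toReal)) with hc
  have hc0 : 0 < c := by positivity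
  set f : (Fin d → ℝ) → ℂ := fun x => ∑ k ∈ Λ, (fun _ => (c : ℂ)) k * expk d k x with hf
  have hfi : IntegrableOn f (cube d) := integrableOn_trigPoly d Λ _
  have hfk : ∀ k, fCoeff d f k = if k ∈ Λ then (c : ℂ) else 0 := fCoeff_trigPoly d Λ _
  have hcoef : ∀ k ∈ Λ, wt d k ^ r * ‖fCoeff d f k‖ ≤ (2 * m : ℝ) ^ (-(1 / θ.toReal)) := by
    intro k hk
    rw [hfk, if_pos hk, Complex.norm_of_nonneg hc0.le]
    calc wt d k ^ r * c ≤ M ^ r * c := by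
          gcongr
          · exact (wt_pos d k).le
          · exact hΛ k hk
      _ = _ := by
          rw [hc, Real.rpow_neg hM.le]
          field_simp
  have hcoef' : ∀ k ∉ Λ, wt d k ^ r * ‖fCoeff d f k‖ = 0 := by
    intro k hk
    rw [hfk, if_neg hk, norm_zero, mul_zero]
  have hball : f ∈ unitBall d (wienerNorm d r θ) := by
    refine ⟨hfi, ?_⟩
    by_cases hθt : θ = ∞
    · subst hθt
      rw [wienerNorm_top]
      refine iSup_le fun k => ?_
      rw [ENNReal.ofReal_le_one]
      by_cases hk : k ∈ Λ
      · simpa using hcoef k hk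
      · rw [hcoef' k hk]
        exact zero_le_one
    · have hp0 : 0 < θ.toReal := ENNReal.toReal_pos hθ.ne' hθt
      rw [wienerNorm_of_ne_top _ _ hθt, one_div, ENNReal.rpow_inv_le_iff hp0, ENNReal.one_rpow,
        tsum_eq_sum (s := Λ) (fun k hk => by
          rw [hcoef' k hk, Real.zero_rpow hp0.ne', ENNReal.ofReal_zero])]
      have hle : ∀ k ∈ Λ, ENNReal.ofReal ((wt d k ^ r * ‖fCoeff d f k‖) ^ θ.toReal)
          ≤ ENNReal.ofReal ((2 * m : ℝ)⁻¹) := by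
        intro k hk
        refine ENNReal.ofReal_le_ofReal ?_
        have h0 := Real.rpow_nonneg (wt_pos d k).le r
        refine (Real.rpow_le_rpow (by positivity) (hcoef k hk) hp0.le).trans (le_of_eq ?_)
        rw [← Real.rpow_mul (by positivity), neg_mul, one_div_mul_cancel hp0.ne', Real.rpow_neg_one]
      refine (Finset.sum_le_card_nsmul _ _ _ hle).trans (le_of_eq ?_)
      rw [hcard, nsmul_eq_mul, ← ENNReal.ofReal_natCast, ← ENNReal.ofReal_mul (by positivity)]
      push_cast
      rw [mul_inv_cancel₀ (by positivity), ENNReal.ofReal_one]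
  refine le_trans ?_ (le_iSup₂ (f := fun f _ => sigmaF d m (wienerNorm d 0 η) f) f hball)
  refine le_iInf₂ ?_
  rintro s ⟨Λ', a, hΛ', rfl⟩
  have hdiff : m ≤ (Λ \ Λ').card := by
    have := Finset.le_card_sdiff Λ' Λ
    omega
  have hck : ∀ k ∈ Λ \ Λ', wt d k ^ (0 : ℝ) *
      ‖fCoeff d (f - fun x => ∑ k ∈ Λ', a k * expk d k x) k‖ = c := by
    intro k hk
    rw [Finset.mem_sdiff] at hk
    rw [fCoeff_sub_trigPoly hfi, hfk, if_pos hk.1, if_neg hk.2, sub_zero, Real.rpow_zero, one_mul,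
      Complex.norm_of_nonneg hc0.le]
  by_cases hηt : η = ∞
  · subst hηt
    obtain ⟨k, hk⟩ : (Λ \ Λ').Nonempty := Finset.card_pos.1 (by omega)
    rw [wienerNorm_top]
    refine le_trans ?_ (le_iSup _ k)
    rw [hck k hk]
    simp
  · have hp0 : 0 < η.toReal := ENNReal.toReal_pos hη.ne' hηt
    rw [wienerNorm_of_ne_top _ _ hηt, one_div, ENNReal.le_rpow_inv_iff hp0,
      ENNReal.ofReal_rpow_of_nonneg (by positivity) hp0.le]
    refine le_trans ?_ (ENNReal.sum_le_tsum (Λ \ Λ'))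
    rw [Finset.sum_congr rfl fun k hk => by rw [hck k hk], Finset.sum_const, nsmul_eq_mul,
      ← ENNReal.ofReal_natCast, ← ENNReal.ofReal_mul (by positivity)]
    refine ENNReal.ofReal_le_ofReal ?_
    rw [Real.mul_rpow hc0.le (by positivity), ← Real.rpow_mul hm0.le, inv_mul_cancel₀ hp0.ne',
      Real.rpow_one, mul_comm]
    gcongr

lemma one_le_logStar (m : ℕ) : 1 ≤ logStar m := le_max_right _ _

lemma one_add_log_le_two_mul_logStar (m : ℕ) : 1 + Real.log m ≤ 2 * logStar m := by
  have h1 := one_le_logStar m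
  have h2 : Real.logb 2 m ≤ logStar m := le_max_left _ _
  have h3 : Real.log m ≤ Real.logb 2 m := by
    rw [Real.logb]
    refine le_div_self (Real.log_natCast_nonneg m) (Real.log_pos (by norm_num)) ?_
    linarith [Real.log_two_lt_d9]
  linarith

lemma logStar_mul_log_two {m : ℕ} (hm : 2 ≤ m) : logStar m * Real.log 2 = Real.log m := by
  have h2 : (0 : ℝ) < Real.log 2 := Real.log_pos (by norm_num)
  have h : 1 ≤ Real.logb 2 m := by
    rw [Real.le_logb_iff_rpow_le (by norm_num) (by positivity), Real.rpow_one]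
    exact_mod_cast hm
  rw [logStar, max_eq_left h, Real.logb, div_mul_cancel₀ _ h2.ne']

lemma eventually_logStar_pow_le (n : ℕ) :
    ∀ᶠ m : ℕ in Filter.atTop, logStar m ^ n ≤ (m : ℝ) ^ (1 / 2 : ℝ) := by
  have hlog2 : (0 : ℝ) < Real.log 2 := Real.log_pos (by norm_num)
  have h := (isLittleO_log_rpow_rpow_atTop (n : ℝ) (show (0 : ℝ) < 1 / 2 by norm_num)).bound
    (show 0 < Real.log 2 ^ n by positivity)
  filter_upwards [tendsto_natCast_atTop_atTop.eventually h, Filter.eventually_ge_atTop 2]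
    with m hm hm2
  rw [Real.rpow_natCast, ← logStar_mul_log_two hm2, mul_pow] at hm
  have hL := one_le_logStar m
  rw [Real.norm_of_nonneg (by positivity), Real.norm_of_nonneg (by positivity), mul_comm] at hm
  exact le_of_mul_le_mul_left hm (by positivity)

lemma exists_finset_card_eq (n : ℕ) : ∃ C : ℝ, 0 < C ∧ ∀ᶠ m : ℕ in Filter.atTop,
    ∃ Λ : Finset (Fin (n + 1) → ℤ), Λ.card = 2 * m ∧
      ∀ k ∈ Λ, wt (n + 1) k ≤ C * m / logStar m ^ n := by
  have hlog2 : (0 : ℝ) < Real.log 2 := Real.log_pos (by norm_num)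
  set B : ℝ := 2 * (n + 1) / Real.log 2 with hB
  have hB1 : 1 ≤ B := by
    rw [hB, one_le_div hlog2]
    linarith [Real.log_two_lt_d9, n.cast_nonneg (α := ℝ)]
  clear_value B
  refine ⟨4 * B ^ n, by positivity, ?_⟩
  filter_upwards [eventually_logStar_pow_le n, Filter.eventually_ge_atTop 2] with m hm hm2
  have hm1 : (1 : ℝ) ≤ m := by exact_mod_cast (by omega : 1 ≤ m)
  have hm0 : (0 : ℝ) < m := by linarith
  set L := logStar m with hL
  have hL0 : 0 < L := zero_lt_one.trans_le (one_le_logStar m)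
  set x : ℝ := (m : ℝ) ^ (1 / (2 * (n + 1)) : ℝ) with hx
  have hx0 : 0 < x := by positivity
  have hQ : (⌊x⌋₊ : ℝ) ^ n ≤ 4 * B ^ n * m / L ^ n := by
    calc (⌊x⌋₊ : ℝ) ^ n ≤ x ^ n := by gcongr; exact Nat.floor_le hx0.le
      _ = (m : ℝ) ^ ((n : ℝ) / (2 * (n + 1))) := by
          rw [hx, ← Real.rpow_natCast, ← Real.rpow_mul hm0.le]
          congr 1
          ring
      _ ≤ (m : ℝ) ^ (1 / 2 : ℝ) := by
          refine Real.rpow_le_rpow_of_exponent_le hm1 ?_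
          rw [div_le_div_iff₀ (by positivity) (by norm_num)]
          linarith
      _ ≤ m / L ^ n := by
          rw [le_div_iff₀ (by positivity)]
          calc (m : ℝ) ^ (1 / 2 : ℝ) * L ^ n ≤ (m : ℝ) ^ (1 / 2 : ℝ) * (m : ℝ) ^ (1 / 2 : ℝ) := by
                gcongr
            _ = m := by rw [← Real.rpow_add hm0]; norm_num
      _ ≤ 4 * B ^ n * m / L ^ n := by
          gcongr
          have : 1 ≤ B ^ n := one_le_pow₀ hB1
          exact le_mul_of_one_le_left hm0.le (by linarith)
  obtain ⟨Λ, hΛ, hcard⟩ := exists_finset_wt_le n ⌊x⌋₊ hQ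
  have hlogx : L / B ≤ Real.log (⌊x⌋₊ + 1) := by
    calc L / B = Real.log x := by
          rw [hx, Real.log_rpow hm0, ← logStar_mul_log_two hm2, ← hL, hB]
          field_simp
      _ ≤ _ := Real.log_le_log hx0 (Nat.lt_floor_add_one x).le
  have h2m : 2 * m ≤ Λ.card := by
    have h : (2 * m : ℝ) ≤ Λ.card := by
      refine le_trans ?_ hcard
      calc (2 * m : ℝ) = 4 * B ^ n * m / L ^ n / 2 * (L / B) ^ n := by
            rw [div_pow L B]
            field_simp
            norm_num
        _ ≤ _ := by gcongr
    exact_mod_cast h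
  obtain ⟨Λ', hsub, hcard'⟩ := Finset.exists_subset_card_eq h2m
  exact ⟨Λ', hcard', fun k hk => hΛ k (hsub hk)⟩

/-- `σ_m(S^r_θ A)_{A_η} ≍ m^{1/η-1/θ-r} (log* m)^{(d-1)r}`
for `θ, η ∈ (0,∞]` and `r > (1/η - 1/θ)₊`. -/
theorem statement6 (d : ℕ) (hd : 1 ≤ d) (θ η : ℝ≥0∞) (hθ : 0 < θ) (hη : 0 < η)
    (r : ℝ) (hr : max (1/η.toReal - 1/θ.toReal) 0 < r) :
    IsAsympEquiv (fun m => sigmaClass d m (wienerNorm d r θ) (wienerNorm d 0 η))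
      (fun m => (m : ℝ) ^ (1/η.toReal - 1/θ.toReal - r) *
        logStar m ^ (((d : ℝ) - 1) * r)) := by
  obtain ⟨n, rfl⟩ : ∃ n, d = n + 1 := ⟨d - 1, by omega⟩
  have hr0 : 0 < r := (le_max_right _ _).trans_lt hr
  obtain ⟨C, hC, hup⟩ := exists_sigmaClass_le n hr0 hθ hη ((le_max_left _ _).trans_lt hr)
  obtain ⟨D, hD, hlow⟩ := exists_finset_card_eq n
  obtain ⟨m₀, hm₀⟩ := Filter.eventually_atTop.1 hlow
  have hd1 : ((n + 1 : ℕ) : ℝ) - 1 = n := by push_cast; ring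
  refine ⟨D ^ (-r) * 2 ^ (-(1 / θ.toReal)), C * 2 ^ ((n : ℝ) * r), by positivity, by positivity,
    max m₀ 1, fun m hm => ?_⟩
  have hm1 : 1 ≤ m := (le_max_right _ _).trans hm
  have hmpos : (0 : ℝ) < m := by exact_mod_cast hm1
  have hL0 : 0 < logStar m := zero_lt_one.trans_le (one_le_logStar m)
  simp only [hd1]
  constructor
  · obtain ⟨Λ, hcard, hΛ⟩ := hm₀ m ((le_max_left _ _).trans hm)
    refine le_trans (le_of_eq ?_) (ofReal_le_sigmaClass hm1 hr0 hθ hη (by positivity) hcard hΛ)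
    congr 1
    rw [Real.div_rpow (by positivity) (by positivity), Real.mul_rpow hD.le hmpos.le,
      Real.mul_rpow (by norm_num) hmpos.le, ← Real.rpow_natCast (logStar m) n,
      ← Real.rpow_mul hL0.le, mul_neg, Real.rpow_neg hL0.le,
      show 1 / η.toReal - 1 / θ.toReal - r = -r + -(1 / θ.toReal) + 1 / η.toReal by ring,
      Real.rpow_add hmpos, Real.rpow_add hmpos, div_inv_eq_mul]
    ring
  · refine (hup m hm1).trans (ENNReal.ofReal_le_ofReal ?_)
    have hlog := Real.log_natCast_nonneg m
    calc C * ((m : ℝ) ^ (1 / η.toReal - 1 / θ.toReal - r) * (1 + Real.log m) ^ ((n : ℝ) * r))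
        ≤ C * ((m : ℝ) ^ (1 / η.toReal - 1 / θ.toReal - r)
            * (2 * logStar m) ^ ((n : ℝ) * r)) := by
          gcongr
          exact one_add_log_le_two_mul_logStar m
      _ = _ := by
          rw [Real.mul_rpow (by norm_num) hL0.le]
          ring

end Paper
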